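/- There is no real number t with 0 < t < 1 and no monic polynomial b(x) of degree at most 200 with nonnegative real coefficients and b(0) = 1 such that (1 + t x^3 + x^5)·b(x) has all coefficients in {0,1}. -/

import Mathlib

open Polynomial

/-- The `n`-th coefficient of `(1 + t x ^ m + x ^ 5) * ∑ f i x ^ i`. -/
def trinomialMulCoeff (t : ℝ) (m : ℕ) (f : ℕ → ℝ) (n : ℕ) : ℝ :=
  f n + t * (if m ≤ n then f (n - m) else 0) + (if 5 ≤ n then f (n - 5) else 0)

theorem coeff_trinomial_mul (t : ℝ) (m : ℕ) (p : ℝ[X]) (n : ℕ) :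
    ((1 + C t * X ^ m + X ^ 5) * p).coeff n = trinomialMulCoeff t m p.coeff n := by
  simp [trinomialMulCoeff, add_mul, mul_assoc, coeff_X_pow_mul']

/-- If a sum of nonnegative terms `x`, `t * y`, `z` lies in `{0, 1}` and one of the last two is
positive, then the sum is `1`. -/
theorem eq_one_sub_of_pos {t x y z : ℝ} (h : x + t * y + z = 0 ∨ x + t * y + z = 1)
    (ht : 0 < t) (hx : 0 ≤ x) (hy : 0 ≤ y) (hz : 0 ≤ z) (hpos : 0 < y ∨ 0 < z) :
    x = 1 - t * y - z := by
  have hty : 0 ≤ t * y := mul_nonneg ht.le hy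
  have hs : 0 < t * y + z := by
    rcases hpos with hy' | hz'
    · linarith [mul_pos ht hy']
    · linarith
  rcases h with h | h <;> linarith

theorem sextic_neg {t : ℝ} (h : 39 / 100 ≤ t) (h' : t ≤ 1 / 2) :
    2 - 6 * t + 3 * t ^ 2 - 4 * t ^ 3 + 5 * t ^ 4 - 6 * t ^ 5 + 7 * t ^ 6 < 0 := by
  have ht : 0 ≤ t := by linarith
  have hlow : 0 ≤ (t - 39 / 100) * (5.141805 - 2.2005 * t + 2.05 * t ^ 2 - 5 * t ^ 3) := by
    refine mul_nonneg (by linarith) ?_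
    have hcube : t ^ 3 ≤ (1 / 2) ^ 3 := by gcongr
    nlinarith [sq_nonneg t]
  have hhigh : 0 ≤ t ^ 5 * (6 - 7 * t) := mul_nonneg (by positivity) (by linarith)
  linarith

theorem quintic_neg {t : ℝ} (h : t < 39 / 100) :
    -1 + 4 * t - 7 * t ^ 2 + 11 * t ^ 3 - 16 * t ^ 4 + 21 * t ^ 5 < 0 := by
  have hfac : 0 < (39 / 100 - t) * (t ^ 2 * (21 * t ^ 2 - 7.81 * t + 1) +
      (6.9541 * t ^ 2 - 3.897901 * t + 2.47981861)) := by
    refine mul_pos (by linarith) (add_pos_of_nonneg_of_pos (mul_nonneg (sq_nonneg t) ?_) ?_)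
    · nlinarith [sq_nonneg (t - 0.186)]
    · nlinarith [sq_nonneg (t - 0.28)]
  linarith

set_option maxHeartbeats 1000000 in
/-- Nonnegative `f` with `f 0 = 1` and `(1 + t x ^ 2 + x ^ 5) * f` a 0-1 series forces `t` to be
small. -/
theorem lt_of_zero_one_of_two {t : ℝ} {f : ℕ → ℝ} (ht0 : 0 < t) (ht1 : t < 1)
    (hf : ∀ n, 0 ≤ f n) (hf0 : f 0 = 1)
    (h : ∀ n, trinomialMulCoeff t 2 f n = 0 ∨ trinomialMulCoeff t 2 f n = 1) :
    t < 39 / 100 := by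
  have step (n : ℕ) (hpos : 0 < f (n + 3) ∨ 0 < f n) :
      f (n + 5) = 1 - t * f (n + 3) - f n := by
    refine eq_one_sub_of_pos ?_ ht0 (hf _) (hf _) (hf _) hpos
    simpa [trinomialMulCoeff] using h (n + 5)
  have le_step (n : ℕ) : f (n + 5) ≤ 1 - t * f (n + 3) - f n := by
    have := h (n + 5)
    simp only [trinomialMulCoeff, le_add_iff_nonneg_left, Nat.zero_le, if_true,
      Nat.add_sub_cancel, show 2 ≤ n + 5 by omega, show n + 5 - 2 = n + 3 by omega] at this
    rcases this with h | h <;> linarith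
  have h1 : f 1 = 0 ∨ f 1 = 1 := by simpa [trinomialMulCoeff] using h 1
  have h2 : f 2 = 1 - t := by
    have := h 2
    simp only [trinomialMulCoeff] at this
    norm_num [hf0] at this
    rcases this with h | h <;> linarith [hf 2]
  have h3 : f 3 + t * f 1 = 0 ∨ f 3 + t * f 1 = 1 := by simpa [trinomialMulCoeff] using h 3
  have h4 : f 4 = 1 - t + t ^ 2 := by
    have := h 4
    simp only [trinomialMulCoeff] at this
    norm_num [h2] at this
    rcases this with h | h <;> nlinarith [hf 4]
  have h5 := le_step 0
  norm_num [hf0] at h5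
  have h3z : f 3 = 0 := by
    have := hf 5
    have := hf 3
    nlinarith
  have h5z : f 5 = 0 := by
    have := hf 5
    rw [h3z] at h5
    linarith
  have h1z : f 1 = 0 := by
    rw [h3z] at h3
    rcases h1 with h1 | h1
    · exact h1
    · rw [h1] at h3
      rcases h3 with h | h <;> linarith
  have p4 : 0 < f 4 := by rw [h4]; nlinarith
  have h6 : f 6 = 1 - t + t ^ 2 - t ^ 3 := by
    rw [step 1 (.inl p4), h4, h1z]; ring
  have p6 : 0 < f 6 := by
    rw [h6]; nlinarith [mul_pos (sub_pos.2 ht1) (by positivity : 0 < 1 + t ^ 2)]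
  have h7 : f 7 = t := by
    rw [step 2 (.inr (by linarith)), h2, h5z]; ring
  have h8 : f 8 = 1 - t + t ^ 2 - t ^ 3 + t ^ 4 := by
    rw [step 3 (.inl p6), h6, h3z]; ring
  have h9 : f 9 = t - 2 * t ^ 2 := by
    rw [step 4 (.inr p4), h4, h7]; ring
  have ht2 : t ≤ 1 / 2 := by
    have := hf 9
    rw [h9] at this
    nlinarith
  have p8 : 0 < f 8 := by rw [h8]; nlinarith [pow_pos ht0 2, pow_pos ht0 4]
  have p7 : 0 < f 7 := by rw [h7]; exact ht0
  have h10 : f 10 = 1 - t * f 8 := by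
    rw [step 5 (.inl p8), h5z]; ring
  have h11 : f 11 = t - 2 * t ^ 2 + 3 * t ^ 3 := by
    rw [step 6 (.inr p6), h9, h6]; ring
  have p11 : 0 < f 11 := by rw [h11]; nlinarith [pow_pos ht0 2, pow_pos ht0 3]
  have h12 : f 12 = 1 - t * f 10 - t := by
    rw [step 7 (.inr p7), h7]
  have h13 : f 13 = 1 - t * f 11 - f 8 := step 8 (.inr p8)
  have h14 : f 14 = 1 - t * f 12 - f 9 := by
    refine step 9 (.inl ?_)
    show 0 < f 12
    have : f 10 < 1 := by rw [h10]; nlinarith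
    rw [h12]
    nlinarith
  have h15 : f 15 = 1 - t * f 13 - f 10 := by
    refine step 10 (.inr ?_)
    rw [h10, h8]
    nlinarith [pow_pos ht0 2, pow_pos ht0 3, pow_pos ht0 4]
  have h17 : f 17 = 1 - t * f 15 - f 12 := by
    refine step 12 (.inr ?_)
    have : f 10 < 1 := by rw [h10]; nlinarith
    rw [h12]
    nlinarith
  have h19 := le_step 14
  norm_num at h19
  by_contra! hlt
  have hval : 1 - t * f 17 - f 14 =
      t * (2 - 6 * t + 3 * t ^ 2 - 4 * t ^ 3 + 5 * t ^ 4 - 6 * t ^ 5 + 7 * t ^ 6) := by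
    rw [h17, h15, h14, h13, h12, h11, h10, h9, h8]; ring
  have hneg : 2 - 6 * t + 3 * t ^ 2 - 4 * t ^ 3 + 5 * t ^ 4 - 6 * t ^ 5 + 7 * t ^ 6 < 0 :=
    sextic_neg hlt ht2
  have := hf 19
  rw [hval] at h19
  linarith [mul_neg_of_pos_of_neg ht0 hneg]

set_option maxHeartbeats 1000000 in
/-- For small `t`, no nonnegative `f` with `f 0 = 1` makes `(1 + t x ^ 3 + x ^ 5) * f` a 0-1
series. -/
theorem not_zero_one_of_three {t : ℝ} {f : ℕ → ℝ} (ht0 : 0 < t) (ht1 : t < 39 / 100)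
    (hf : ∀ n, 0 ≤ f n) (hf0 : f 0 = 1)
    (h : ∀ n, trinomialMulCoeff t 3 f n = 0 ∨ trinomialMulCoeff t 3 f n = 1) :
    False := by
  have step (n : ℕ) (hpos : 0 < f (n + 2) ∨ 0 < f n) :
      f (n + 5) = 1 - t * f (n + 2) - f n := by
    refine eq_one_sub_of_pos ?_ ht0 (hf _) (hf _) (hf _) hpos
    simpa [trinomialMulCoeff] using h (n + 5)
  have le_step (n : ℕ) : f (n + 5) ≤ 1 - t * f (n + 2) - f n := by
    have := h (n + 5)
    simp only [trinomialMulCoeff, le_add_iff_nonneg_left, Nat.zero_le, if_true,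
      Nat.add_sub_cancel, show 3 ≤ n + 5 by omega, show n + 5 - 3 = n + 2 by omega] at this
    rcases this with h | h <;> linarith
  /- A coefficient `f n` whose own product coefficient is undetermined is killed two places
  later, where it meets a positive term. -/
  have zero_step (n : ℕ) (hn : f n = 0 ∨ f n = 1) (hpos : 0 < f (n + 2)) : f n = 0 := by
    have := le_step n
    have := hf (n + 5)
    have := mul_pos ht0 hpos
    rcases hn with hn | hn
    · exact hn
    · linarith
  have h3 : f 3 = 1 - t := by
    have := h 3
    simp only [trinomialMulCoeff] at this
    norm_num [hf0] at this
    rcases this with h | h <;> linarith [hf 3]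
  have p3 : 0 < f 3 := by rw [h3]; linarith
  have h1 : f 1 = 0 := zero_step 1 (by simpa [trinomialMulCoeff] using h 1) p3
  have h5 := le_step 0
  norm_num [hf0] at h5
  have h2 : f 2 = 0 := by
    have := hf 5
    have := hf 2
    nlinarith
  have h5z : f 5 = 0 := by
    have := hf 5
    rw [h2] at h5
    linarith
  have h6 : f 6 = 1 - t + t ^ 2 := by
    rw [step 1 (.inl p3), h1, h3]; ring
  have p6 : 0 < f 6 := by rw [h6]; nlinarith
  have h4 : f 4 = 0 := zero_step 4 (by simpa [trinomialMulCoeff, h1] using h 4) p6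
  have h8 : f 8 = t := by
    rw [step 3 (.inr p3), h5z, h3]; ring
  have h9 : f 9 = 1 - t * f 6 := by
    rw [step 4 (.inl p6), h4]; ring
  have p9 : 0 < f 9 := by rw [h9, h6]; nlinarith [pow_pos ht0 2]
  have h7 : f 7 = 0 := zero_step 7 (by simpa [trinomialMulCoeff, h4, h2] using h 7) p9
  have h11 : f 11 = t - 2 * t ^ 2 := by
    rw [step 6 (.inr p6), h8, h6]; ring
  have p11 : 0 < f 11 := by rw [h11]; nlinarith
  have h12 : f 12 = 1 - t * f 9 := by
    rw [step 7 (.inl p9), h7]; ring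
  have l9 : f 9 < 1 := by rw [h9]; nlinarith
  have p12 : 0 < f 12 := by rw [h12]; nlinarith
  have h10 : f 10 = 0 := zero_step 10 (by simpa [trinomialMulCoeff, h7, h5z] using h 10) p12
  have h13 : f 13 = 1 - t := by
    rw [step 8 (.inr (by rw [h8]; exact ht0)), h10, h8]; ring
  have h14 : f 14 = 1 - t * f 11 - f 9 := step 9 (.inr p9)
  have h15 : f 15 = 1 - t * f 12 := by
    rw [step 10 (.inl p12), h10]; ring
  have h16 : f 16 = 1 - 2 * t + 3 * t ^ 2 := by
    rw [step 11 (.inr p11), h13, h11]; ring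
  have p16 : 0 < f 16 := by rw [h16]; nlinarith
  have h17 : f 17 = 1 - t * f 14 - f 12 := step 12 (.inr p12)
  have h18 : f 18 = t ^ 2 * f 12 := by
    rw [step 13 (.inr (by rw [h13]; linarith)), h13, h15]; ring
  have p18 : 0 < f 18 := by rw [h18]; positivity
  have h19 : f 19 = 1 - t * f 16 - f 14 := step 14 (.inl p16)
  have p15 : 0 < f 15 := by
    have : f 12 < 1 := by rw [h12]; nlinarith
    rw [h15]; nlinarith
  have h20 : f 20 = 1 - t * f 17 - f 15 := step 15 (.inr p15)
  have h22 : f 22 = 1 - t * f 19 - f 17 := by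
    refine step 17 (.inl ?_)
    show 0 < f 19
    rw [h19, h16, h14, h11, h9, h6]
    nlinarith [pow_pos ht0 2, pow_pos ht0 3]
  have h23 : f 23 = 1 - t * f 20 - f 18 := step 18 (.inr p18)
  have h25 : f 25 = 1 - t * f 22 - f 20 := by
    refine step 20 (.inl ?_)
    show 0 < f 22
    rw [h22, h19, h17, h16, h14, h12, h11, h9, h6]
    nlinarith [pow_pos ht0 2, pow_pos ht0 3, pow_pos ht0 4]
  have h28 := le_step 23
  norm_num at h28
  have hval : 1 - t * f 25 - f 23 =
      t * (-1 + 4 * t - 7 * t ^ 2 + 11 * t ^ 3 - 16 * t ^ 4 + 21 * t ^ 5) := by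
    rw [h25, h23, h22, h20, h19, h18, h17, h16, h15, h14, h12, h11, h9, h6]; ring
  have hneg : -1 + 4 * t - 7 * t ^ 2 + 11 * t ^ 3 - 16 * t ^ 4 + 21 * t ^ 5 < 0 :=
    quintic_neg ht1
  have := hf 28
  rw [hval] at h28
  linarith [mul_neg_of_pos_of_neg ht0 hneg]

theorem reflect_trinomial (t : ℝ) :
    reflect 5 (1 + C t * X ^ 3 + X ^ 5 : ℝ[X]) = 1 + C t * X ^ 2 + X ^ 5 := by
  have h1 : reflect 5 (1 : ℝ[X]) = X ^ 5 := by
    simp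
  have h5 : reflect 5 (X ^ 5 : ℝ[X]) = 1 := by
    simp
  rw [reflect_add, reflect_add, reflect_C_mul_X_pow, h1, h5, revAt_le (by norm_num)]
  ring

theorem no_unfair_one_tx3_x5_deg200 :
    ¬ ∃ (t : ℝ) (b : ℝ[X]), 0 < t ∧ t < 1 ∧ b.Monic ∧ b.coeff 0 = 1 ∧
      b.natDegree ≤ 200 ∧ (∀ n, 0 ≤ b.coeff n) ∧
      (∀ n, ((1 + C t * X ^ 3 + X ^ 5) * b).coeff n = 0 ∨
            ((1 + C t * X ^ 3 + X ^ 5) * b).coeff n = 1) := by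
  rintro ⟨t, b, ht0, ht1, hmonic, hb0, -, hb, hc⟩
  refine not_zero_one_of_three ht0 ?_ hb hb0 fun n => by
    simpa only [coeff_trinomial_mul] using hc n
  have hdeg : (1 + C t * X ^ 3 + X ^ 5 : ℝ[X]).natDegree ≤ 5 := by compute_degree
  refine lt_of_zero_one_of_two (f := (reflect b.natDegree b).coeff) ht0 ht1
    (fun n => ?_) ?_ fun n => ?_
  · rw [coeff_reflect]
    exact hb _
  · rw [coeff_reflect, revAt_le (Nat.zero_le _)]
    exact hmonic
  · rw [← coeff_trinomial_mul, ← reflect_trinomial, ← reflect_mul _ _ hdeg le_rfl, coeff_reflect]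
    exact hc _
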